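/- arXiv:1209.2933 — 2 statements merged into one kernel-verified Lean document; each statement's English description precedes it below -/
import Mathlib

section
/- The constant term of the q=0 symmetric Koornwinder density equals ∏_{i=0}^{n−1} [(1−t^i ac)(1−t^i bc)(1−t^i cd)(1−t^i ad)(1−t^i bd)(1−t^i ab)]^{−1} · ∏_{j=0}^{n−1}(1−t^{2n−2−j}abcd) · ∏_{j=1}^{n} (1−t)/(1−t^j), for parameters a, b, c, d, t of absolute value less than 1. -/
open Finset MeasureTheory

/-- Normalized integral over the `n`-torus `{|z_i| = 1}` against Haar measure
`∏_j dz_j/(2πi z_j)`, parametrized by `z_i = e^{iθ_i}`. -/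
noncomputable def torusInt (n : ℕ) (f : (Fin n → ℂ) → ℂ) : ℂ :=
  ((2 * Real.pi : ℂ))⁻¹ ^ n *
    ∫ θ : Fin n → ℝ in Set.univ.pi fun _ : Fin n => Set.Ioc (0 : ℝ) (2 * Real.pi),
      f fun i => Complex.exp (Complex.I * θ i)

/-- The `q = 0` symmetric Koornwinder density `Δ̃_K^{(n)}(z;t;a,b,c,d)`. -/
noncomputable def symDensity (n : ℕ) (t a b c d : ℂ) (z : Fin n → ℂ) : ℂ :=
  ((2 ^ n * (n.factorial : ℂ)))⁻¹ *
  (∏ i : Fin n, ((1 - z i ^ 2) * (1 - ((z i)⁻¹) ^ 2)) /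
      ((1 - a * z i) * (1 - a * (z i)⁻¹) * (1 - b * z i) * (1 - b * (z i)⁻¹) *
        (1 - c * z i) * (1 - c * (z i)⁻¹) * (1 - d * z i) * (1 - d * (z i)⁻¹))) *
  ∏ i : Fin n, ∏ j : Fin n,
    if i < j then
      ((1 - z i * z j) * (1 - z i * (z j)⁻¹) * (1 - (z i)⁻¹ * z j) * (1 - (z i)⁻¹ * (z j)⁻¹)) /
        ((1 - t * z i * z j) * (1 - t * z i * (z j)⁻¹) *
          (1 - t * (z i)⁻¹ * z j) * (1 - t * (z i)⁻¹ * (z j)⁻¹))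
    else 1

/-- The point `(e^{iθ_j})_j` of the torus. -/
noncomputable def expTorus {n : ℕ} (θ : Fin n → ℝ) : Fin n → ℂ :=
  fun i => Complex.exp (Complex.I * θ i)

theorem norm_expTorus {n : ℕ} (θ : Fin n → ℝ) (i : Fin n) : ‖expTorus θ i‖ = 1 := by
  rw [expTorus, mul_comm, Complex.norm_exp_ofReal_mul_I]

@[fun_prop]
theorem continuous_expTorus {n : ℕ} : Continuous (expTorus (n := n)) := by
  unfold expTorus; fun_prop

theorem torusInt_eq_setIntegral_Icc (n : ℕ) (f : (Fin n → ℂ) → ℂ) :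
    torusInt n f = ((2 * Real.pi : ℂ))⁻¹ ^ n *
      ∫ θ in Set.Icc (0 : Fin n → ℝ) (fun _ => 2 * Real.pi), f (expTorus θ) := by
  unfold torusInt
  congr 1
  exact setIntegral_congr_set (Measure.univ_pi_Ioc_ae_eq_Icc (f := (0 : Fin n → ℝ)))

theorem torusInt_congr {n : ℕ} {f g : (Fin n → ℂ) → ℂ}
    (h : ∀ z, (∀ i, ‖z i‖ = 1) → f z = g z) : torusInt n f = torusInt n g := by
  rw [torusInt_eq_setIntegral_Icc, torusInt_eq_setIntegral_Icc]
  simp only [h _ (norm_expTorus _)]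

theorem torusInt_const_mul {n : ℕ} (r : ℂ) (f : (Fin n → ℂ) → ℂ) :
    torusInt n (fun z => r * f z) = r * torusInt n f := by
  rw [torusInt_eq_setIntegral_Icc, torusInt_eq_setIntegral_Icc, integral_const_mul]
  ring

theorem integrableOn_Icc_expTorus {n : ℕ} {f : (Fin n → ℂ) → ℂ}
    (hf : Continuous fun θ => f (expTorus θ)) :
    IntegrableOn (fun θ => f (expTorus θ)) (Set.Icc (0 : Fin n → ℝ) (fun _ => 2 * Real.pi)) :=
  hf.continuousOn.integrableOn_compact isCompact_Icc

theorem torusInt_add {n : ℕ} {f g : (Fin n → ℂ) → ℂ}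
    (hf : Continuous fun θ => f (expTorus θ)) (hg : Continuous fun θ => g (expTorus θ)) :
    torusInt n (fun z => f z + g z) = torusInt n f + torusInt n g := by
  simp only [torusInt_eq_setIntegral_Icc]
  rw [integral_add (integrableOn_Icc_expTorus hf) (integrableOn_Icc_expTorus hg), mul_add]

theorem torusInt_sum {ι : Type*} [Fintype ι] {n : ℕ} {f : ι → (Fin n → ℂ) → ℂ}
    (hf : ∀ i, Continuous fun θ => f i (expTorus θ)) :
    torusInt n (fun z => ∑ i, f i z) = ∑ i, torusInt n (f i) := by
  simp only [torusInt_eq_setIntegral_Icc]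
  rw [integral_finsetSum _ fun i _ => integrableOn_Icc_expTorus (hf i), Finset.mul_sum]

open Real in
theorem torusInt_succAbove {n : ℕ} (k : Fin (n + 1)) (f : (Fin (n + 1) → ℂ) → ℂ)
    (hf : Continuous fun θ => f (expTorus θ)) :
    torusInt (n + 1) f =
      torusInt n fun w => circleAverage (fun x => f (k.insertNth x w)) 0 1 := by
  have hins : ∀ (x : ℝ) (w : Fin n → ℝ),
      expTorus (k.insertNth (α := fun _ => ℝ) x w) =
        k.insertNth (α := fun _ => ℂ) (Complex.exp (Complex.I * x)) (expTorus w) := by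
    intro x w
    ext i
    refine Fin.succAboveCases k ?_ (fun j => ?_) i <;> simp [expTorus]
  have e := (volume_preserving_piFinSuccAbove (fun _ : Fin (n + 1) => ℝ) k).symm
  have hpre : (MeasurableEquiv.piFinSuccAbove (fun _ : Fin (n + 1) => ℝ) k).symm ⁻¹'
      Set.Icc 0 (fun _ => 2 * π) = Set.Icc 0 (2 * π) ×ˢ Set.Icc (0 : Fin n → ℝ) fun _ => 2 * π :=
    ((Fin.insertNthOrderIso (fun _ => ℝ) k).preimage_Icc _ _).trans (Set.Icc_prod_eq _ _)
  have hfc : Continuous fun p : ℝ × (Fin n → ℝ) =>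
      f (expTorus (k.insertNth (α := fun _ => ℝ) p.1 p.2)) :=
    hf.comp (Continuous.finInsertNth (A := fun _ => ℝ) k continuous_fst continuous_snd)
  rw [torusInt_eq_setIntegral_Icc, torusInt_eq_setIntegral_Icc,
    ← e.setIntegral_preimage_emb (MeasurableEquiv.measurableEmbedding _), hpre,
    Measure.volume_eq_prod, ← setIntegral_prod_swap, setIntegral_prod, pow_succ, mul_assoc]
  · congr 1
    rw [← integral_const_mul]
    refine setIntegral_congr_fun measurableSet_Icc fun w _ => ?_
    simp only [circleAverage_def, circleMap_zero, Complex.real_smul, Complex.ofReal_one, one_mul]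
    rw [intervalIntegral.integral_of_le (by positivity), ← integral_Icc_eq_integral_Ioc]
    push_cast
    congr 1
    refine setIntegral_congr_fun measurableSet_Icc fun x _ => ?_
    simp only [mul_comm (x : ℂ), ← hins]
    rfl
  · refine ContinuousOn.integrableOn_compact (isCompact_Icc.prod isCompact_Icc) ?_
    exact (hfc.comp continuous_swap).continuousOn

theorem continuous_torusInt {X : Type*} [TopologicalSpace X] [FirstCountableTopology X]
    [LocallyCompactSpace X] {n : ℕ} {f : X → (Fin n → ℂ) → ℂ}
    (hf : Continuous fun p : X × (Fin n → ℝ) => f p.1 (expTorus p.2)) :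
    Continuous fun x => torusInt n (f x) := by
  simp only [torusInt_eq_setIntegral_Icc]
  exact continuous_const.mul
    (continuous_parametric_integral_of_continuous (f := fun x θ => f x (expTorus θ)) hf
      isCompact_Icc)

/-- The one-variable factor of the rational function symmetrized in `sum_cFactor`. -/
noncomputable def cFactor (a b u : ℂ) : ℂ := (1 - a * u) * (1 - b * u) / (1 - u ^ 2)

/-- The two-variable factor of the rational function symmetrized in `sum_cFactor`. -/
noncomputable def cPair (t u y : ℂ) : ℂ :=
  ((1 - t * u * y) * (1 - t * u * y⁻¹)) / ((1 - u * y) * (1 - u * y⁻¹))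

open Polynomial in
theorem sum_lagrange_nodes {ι : Type*} [Fintype ι] [DecidableEq ι] (a b t s : ℂ) (y : ι → ℂ)
    (hy : Function.Injective y) (hy0 : ∀ i, y i ≠ 0) (hs : s ≠ 0) (hys : ∀ i, y i ^ 2 ≠ s ^ 2) :
    ∑ i, (y i - a) * (y i - b) * (∏ j, (y i - t * y j)) /
        (y i * (y i ^ 2 - s ^ 2) * ∏ j, if j = i then 1 else y i - y j) +
      (a * b * (∏ j, (- (t * y j))) / (-s ^ 2 * ∏ j, (- y j)) +
      ((s - a) * (s - b) * (∏ j, (s - t * y j)) / (2 * s ^ 2 * ∏ j, (s - y j)) +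
      (s + a) * (s + b) * (∏ j, (-s - t * y j)) / (2 * s ^ 2 * ∏ j, (-s - y j)))) = 1 := by
  have hys1 : ∀ i, y i ≠ s := fun i h => hys i (by rw [h])
  have hys2 : ∀ i, y i ≠ -s := fun i h => hys i (by rw [h]; ring)
  have hss : s ≠ -s := fun h => hs (self_eq_neg.1 h)
  let P : ℂ[X] := (X - C a) * (X - C b) * ∏ j, (X - C (t * y j))
  have hPm : P.Monic := ((monic_X_sub_C a).mul (monic_X_sub_C b)).mul
    (monic_prod_of_monic _ _ fun j _ => monic_X_sub_C _)
  have hPd : P.natDegree = Fintype.card ι + 2 := by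
    rw [((monic_X_sub_C a).mul (monic_X_sub_C b)).natDegree_mul
      (monic_prod_of_monic _ _ fun j _ => monic_X_sub_C _),
      (monic_X_sub_C a).natDegree_mul (monic_X_sub_C b),
      natDegree_prod_of_monic _ _ fun j _ => monic_X_sub_C _]
    simp only [natDegree_X_sub_C, Finset.sum_const, Finset.card_univ, smul_eq_mul]
    ring
  let v : ι ⊕ Fin 3 → ℂ := Sum.elim y ![0, s, -s]
  have hv : Function.Injective v := by
    refine Function.Injective.sumElim hy ?_ ?_
    · intro i j
      fin_cases i <;> fin_cases j <;> simp [hs, hs.symm, hss, hss.symm]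
    · intro i j
      fin_cases j <;> simp [hy0, hys1, hys2]
  have key := Lagrange.leadingCoeff_eq_sum (s := Finset.univ) (v := v) hv.injOn (P := P)
    (by rw [degree_eq_natDegree hPm.ne_zero, hPd]; simp; norm_cast)
  rw [hPm.leadingCoeff] at key
  refine Eq.trans ?_ key.symm
  have herase : ∀ i, ∏ j ∈ Finset.univ.erase i, (v i - v j) =
      ∏ j, if j = i then 1 else v i - v j := by
    intro i
    rw [← Finset.filter_ne', Finset.prod_filter]
    exact Finset.prod_congr rfl fun j _ => by by_cases h : j = i <;> simp [h]
  simp only [herase, Fintype.sum_sum_type, Fintype.prod_sum_type, Fin.sum_univ_three,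
    Fin.prod_univ_three, P, v, eval_mul, eval_prod, eval_sub, eval_X, eval_C]
  congr 1
  · refine Finset.sum_congr rfl fun i _ => ?_
    simp
    congr 1
    ring
  · simp [← add_assoc]
    congr 1
    congr 1
    · congr 1
      ring
    · congr 1
      ring
    · congr 1
      · ring
      · ring

theorem sum_cFactor_of_sq (n : ℕ) (a b s : ℂ) (hs : s ≠ 0) (hs1 : ‖s‖ < 1)
    (z : Fin (n + 1) → ℂ) (hz : ∀ i, ‖z i‖ = 1) (hz2 : ∀ i, z i ^ 2 ≠ 1)
    (hzz : ∀ i j, i ≠ j → z i ≠ z j ∧ z i * z j ≠ 1) :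
    (1 - s ^ 2) * ∑ k, (cFactor a b (z k)⁻¹ * ∏ j, cPair (s ^ 2) (z k)⁻¹ (z (k.succAbove j)) +
      cFactor a b (z k) * ∏ j, cPair (s ^ 2) (z k) (z (k.succAbove j))) =
    (1 - (s ^ 2) ^ (n + 1)) * (1 - (s ^ 2) ^ n * a * b) := by
  have hz0 : ∀ i, z i ≠ 0 := fun i h => by simpa [h] using hz i
  have hinv : ∀ i j, i ≠ j → z i ≠ (z j)⁻¹ := fun i j hij h =>
    (hzz i j hij).2 (by rw [h, inv_mul_cancel₀ (hz0 j)])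
  have hself : ∀ i, z i ≠ (z i)⁻¹ := fun i h => hz2 i (by
    rw [sq]
    exact (congrArg (z i * ·) h).trans (mul_inv_cancel₀ (hz0 i)))
  let y : Fin (n + 1) × Bool → ℂ := fun p => if p.2 then z p.1 else (z p.1)⁻¹
  have hyn : ∀ p, ‖y p‖ = 1 := by rintro ⟨i, _ | _⟩ <;> simp [y, hz]
  have hy : Function.Injective y := by
    rintro ⟨i, x⟩ ⟨j, x'⟩ h
    by_cases hij : i = j
    · subst hij
      cases x <;> cases x' <;> simp_all [y]
      · exact (hself i h.symm).elim
    · exfalso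
      cases x <;> cases x' <;> simp [y] at h
      · exact (hzz i j hij).1 h
      · exact hinv j i (Ne.symm hij) h.symm
      · exact hinv i j hij h
      · exact (hzz i j hij).1 h
  have hsne : ∀ x : ℂ, ‖x‖ = 1 → x ^ 2 ≠ s ^ 2 := fun x hx h => by
    have := congrArg norm h
    rw [norm_pow, norm_pow, hx] at this
    nlinarith [norm_nonneg s]
  have key := sum_lagrange_nodes a b (s ^ 2) s y hy
    (fun p h => by simpa [h] using hyn p) hs (fun p => hsne _ (hyn p))
  have hne : ∀ x : ℂ, ‖x‖ = 1 → s - x ≠ 0 ∧ -s - x ≠ 0 := fun x hx =>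
    ⟨fun h => hsne x hx (by rw [← sub_eq_zero.1 h]),
      fun h => hsne x hx (by rw [← sub_eq_zero.1 h]; ring)⟩
  have hA : ∏ p, (-(s ^ 2 * y p)) = (s ^ 2) ^ (2 * (n + 1)) * ∏ p, (-y p) := by
    simp_rw [← mul_neg, Finset.prod_mul_distrib]
    simp [mul_comm]
  have hB : ∀ r, r ^ 2 = s ^ 2 →
      ∏ p, (r - s ^ 2 * y p) = (s ^ 2) ^ (n + 1) * ∏ p, (r - y p) := by
    intro r hr
    simp only [Fintype.prod_prod_type, Fintype.prod_bool, y, if_true, Bool.false_eq_true, if_false]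
    rw [← Fin.prod_const (n + 1) (s ^ 2), ← Finset.prod_mul_distrib]
    refine Finset.prod_congr rfl fun i _ => ?_
    have := hz0 i
    rw [← hr]
    field_simp
    ring
  have hA0 : ∏ p, (-y p) ≠ 0 :=
    Finset.prod_ne_zero_iff.2 fun p _ h => by simpa [neg_eq_zero.1 h] using hyn p
  have hB0 : ∏ p, (s - y p) ≠ 0 := Finset.prod_ne_zero_iff.2 fun p _ => (hne _ (hyn p)).1
  have hC0 : ∏ p, (-s - y p) ≠ 0 := Finset.prod_ne_zero_iff.2 fun p _ => (hne _ (hyn p)).2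
  rw [hA, hB s rfl, hB (-s) (neg_sq s)] at key
  have hrest : a * b * ((s ^ 2) ^ (2 * (n + 1)) * ∏ p, (-y p)) / (-s ^ 2 * ∏ p, (-y p)) +
      ((s - a) * (s - b) * ((s ^ 2) ^ (n + 1) * ∏ p, (s - y p)) / (2 * s ^ 2 * ∏ p, (s - y p)) +
      (s + a) * (s + b) * ((s ^ 2) ^ (n + 1) * ∏ p, (-s - y p)) /
        (2 * s ^ 2 * ∏ p, (-s - y p))) =
      1 - (1 - (s ^ 2) ^ (n + 1)) * (1 - (s ^ 2) ^ n * a * b) := by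
    field_simp
    ring
  rw [hrest] at key
  have hmain : (1 - s ^ 2) * ∑ k,
      (cFactor a b (z k)⁻¹ * ∏ j, cPair (s ^ 2) (z k)⁻¹ (z (k.succAbove j)) +
      cFactor a b (z k) * ∏ j, cPair (s ^ 2) (z k) (z (k.succAbove j))) =
      ∑ i, (y i - a) * (y i - b) * (∏ j, (y i - s ^ 2 * y j)) /
        (y i * (y i ^ 2 - s ^ 2) * ∏ j, if j = i then 1 else y i - y j) := by
    have hterm : ∀ (k : Fin (n + 1)) (u : ℂ), u ≠ 0 → (u = z k ∨ u = (z k)⁻¹) →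
        (u - a) * (u - b) * (∏ j, (u - s ^ 2 * z j) * (u - s ^ 2 * (z j)⁻¹)) /
          (u * (u ^ 2 - s ^ 2) *
            ((u - u⁻¹) * ∏ j, (u - z (k.succAbove j)) * (u - (z (k.succAbove j))⁻¹))) =
        (1 - s ^ 2) * (cFactor a b u⁻¹ * ∏ j, cPair (s ^ 2) u⁻¹ (z (k.succAbove j))) := by
      intro k u hu huk
      have hun : ‖u‖ = 1 := by rcases huk with rfl | rfl <;> simp [hz]
      have h1 : u ^ 2 - s ^ 2 ≠ 0 := sub_ne_zero.2 (hsne u hun)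
      have hself : (u - s ^ 2 * z k) * (u - s ^ 2 * (z k)⁻¹) = (1 - s ^ 2) * (u ^ 2 - s ^ 2) := by
        have := hz0 k
        rcases huk with rfl | rfl <;> field_simp
      have hpair : ∀ y : ℂ, y ≠ 0 → cPair (s ^ 2) u⁻¹ y =
          ((u - s ^ 2 * y) * (u - s ^ 2 * y⁻¹)) / ((u - y) * (u - y⁻¹)) := by
        intro y hy
        unfold cPair
        rw [← mul_div_mul_left _ _ (pow_ne_zero 2 hu)]
        congr 1 <;> field_simp
      have hfac : cFactor a b u⁻¹ = (u - a) * (u - b) / (u * (u - u⁻¹)) := by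
        unfold cFactor
        rw [← mul_div_mul_left _ _ (pow_ne_zero 2 hu)]
        congr 1 <;> field_simp
      rw [Fin.prod_univ_succAbove _ k, hself, hfac,
        Finset.prod_congr rfl fun j _ => hpair _ (hz0 _), Finset.prod_div_distrib, div_mul_div_comm,
        ← mul_div_assoc, ← mul_div_mul_left ((1 - s ^ 2) * _) _ h1]
      congr 1 <;> ring
    rw [Fintype.sum_prod_type, Finset.mul_sum]
    refine Finset.sum_congr rfl fun k _ => ?_
    have hden : ∀ x, (∏ j, if j = (k, x) then 1 else y (k, x) - y j) =
        (y (k, x) - (y (k, x))⁻¹) *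
          ∏ j, (y (k, x) - z (k.succAbove j)) * (y (k, x) - (z (k.succAbove j))⁻¹) := by
      intro x
      rw [Fintype.prod_prod_type, Fin.prod_univ_succAbove _ k]
      congr 1
      · cases x <;> simp [y]
      · refine Finset.prod_congr rfl fun j _ => ?_
        simp [y, Fin.succAbove_ne]
    have hnum : ∀ x, ∏ j, (y (k, x) - s ^ 2 * y j) =
        ∏ j, (y (k, x) - s ^ 2 * z j) * (y (k, x) - s ^ 2 * (z j)⁻¹) := by
      intro x
      rw [Fintype.prod_prod_type]
      exact Finset.prod_congr rfl fun j _ => by simp [y]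
    simp only [Fintype.sum_bool, hden, hnum]
    rw [hterm k (y (k, true)) (hz0 k) (Or.inl rfl),
      hterm k (y (k, false)) (inv_ne_zero (hz0 k)) (Or.inr rfl)]
    simp only [y, if_true, Bool.false_eq_true, if_false, inv_inv]
    ring
  rw [hmain]
  linear_combination key

theorem sum_cFactor (n : ℕ) (a b t : ℂ) (ht : ‖t‖ < 1)
    (z : Fin (n + 1) → ℂ) (hz : ∀ i, ‖z i‖ = 1) (hz2 : ∀ i, z i ^ 2 ≠ 1)
    (hzz : ∀ i j, i ≠ j → z i ≠ z j ∧ z i * z j ≠ 1) :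
    (1 - t) * ∑ k, (cFactor a b (z k)⁻¹ * ∏ j, cPair t (z k)⁻¹ (z (k.succAbove j)) +
      cFactor a b (z k) * ∏ j, cPair t (z k) (z (k.succAbove j))) =
    (1 - t ^ (n + 1)) * (1 - t ^ n * a * b) := by
  have hne : ∀ t : ℂ, t ≠ 0 → ‖t‖ < 1 →
      (1 - t) * ∑ k, (cFactor a b (z k)⁻¹ * ∏ j, cPair t (z k)⁻¹ (z (k.succAbove j)) +
        cFactor a b (z k) * ∏ j, cPair t (z k) (z (k.succAbove j))) =
      (1 - t ^ (n + 1)) * (1 - t ^ n * a * b) := by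
    intro t ht0 ht
    obtain ⟨s, rfl⟩ := IsAlgClosed.exists_pow_nat_eq t (n := 2) two_pos
    refine sum_cFactor_of_sq n a b s (by rintro rfl; simp at ht0) ?_ z hz hz2 hzz
    rw [norm_pow] at ht
    exact (sq_lt_one_iff₀ (norm_nonneg s)).1 ht
  rcases eq_or_ne t 0 with rfl | ht0
  · have hcont : Continuous fun t : ℂ =>
        (1 - t) * ∑ k, (cFactor a b (z k)⁻¹ * ∏ j, cPair t (z k)⁻¹ (z (k.succAbove j)) +
          cFactor a b (z k) * ∏ j, cPair t (z k) (z (k.succAbove j))) := by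
      unfold cPair
      fun_prop
    have hcont' : Continuous fun t : ℂ => (1 - t ^ (n + 1)) * (1 - t ^ n * a * b) := by fun_prop
    refine tendsto_nhds_unique_of_eventuallyEq (l := nhdsWithin (0 : ℂ) {0}ᶜ)
      ((hcont.tendsto 0).mono_left nhdsWithin_le_nhds)
      ((hcont'.tendsto 0).mono_left nhdsWithin_le_nhds) ?_
    filter_upwards [self_mem_nhdsWithin,
      nhdsWithin_le_nhds (Metric.ball_mem_nhds (0 : ℂ) one_pos)] with t h0 h1
    exact hne t h0 (by simpa using h1)
  · exact hne t ht0 ht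

/-- The one-variable factor of `symDensity`. -/
noncomputable def koornwinderWeight (a b c d x : ℂ) : ℂ :=
  ((1 - x ^ 2) * (1 - (x⁻¹) ^ 2)) /
    ((1 - a * x) * (1 - a * x⁻¹) * (1 - b * x) * (1 - b * x⁻¹) *
      (1 - c * x) * (1 - c * x⁻¹) * (1 - d * x) * (1 - d * x⁻¹))

/-- The two-variable factor of `symDensity`. -/
noncomputable def pairWeight (t x y : ℂ) : ℂ :=
  ((1 - x * y) * (1 - x * y⁻¹) * (1 - x⁻¹ * y) * (1 - x⁻¹ * y⁻¹)) /
    ((1 - t * x * y) * (1 - t * x * y⁻¹) * (1 - t * x⁻¹ * y) * (1 - t * x⁻¹ * y⁻¹))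

/-- `koornwinderWeight` times `cFactor` at `x⁻¹`: the parameters `a, b` survive only
inside the disc. -/
noncomputable def halfWeight (a b c d x : ℂ) : ℂ :=
  (1 - x ^ 2) /
    ((1 - a * x) * (1 - b * x) * (1 - c * x) * (1 - c * x⁻¹) * (1 - d * x) * (1 - d * x⁻¹))

/-- The part of `pairWeight` that is holomorphic in `x` on the unit disc. -/
noncomputable def halfPair (t x y : ℂ) : ℂ :=
  ((1 - x * y) * (1 - x * y⁻¹)) / ((1 - t * x * y) * (1 - t * x * y⁻¹))

theorem symDensity_eq (n : ℕ) (t a b c d : ℂ) (z : Fin n → ℂ) :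
    symDensity n t a b c d z = ((2 ^ n * (n.factorial : ℂ)))⁻¹ *
      (∏ i, koornwinderWeight a b c d (z i)) *
      ∏ i, ∏ j, if i < j then pairWeight t (z i) (z j) else 1 := rfl

theorem one_sub_mul_ne_zero {s x : ℂ} (hs : ‖s‖ < 1) (hx : ‖x‖ ≤ 1) : 1 - s * x ≠ 0 := by
  intro h
  have h1 : ‖s * x‖ = 1 := by rw [← sub_eq_zero.1 h, norm_one]
  rw [norm_mul] at h1
  nlinarith [norm_nonneg s, norm_nonneg x]

theorem koornwinderWeight_inv (a b c d x : ℂ) :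
    koornwinderWeight a b c d x⁻¹ = koornwinderWeight a b c d x := by
  unfold koornwinderWeight
  rw [inv_inv]
  congr 1 <;> ring

theorem koornwinderWeight_swap (a b c d x : ℂ) :
    koornwinderWeight a b d c x = koornwinderWeight a b c d x := by
  unfold koornwinderWeight
  congr 1
  ring

theorem pairWeight_inv_left (t x y : ℂ) : pairWeight t x⁻¹ y = pairWeight t x y := by
  unfold pairWeight
  rw [inv_inv]
  congr 1 <;> ring

theorem pairWeight_comm (t x y : ℂ) : pairWeight t y x = pairWeight t x y := by
  unfold pairWeight
  congr 1 <;> ring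

theorem symDensity_swap (n : ℕ) (t a b c d : ℂ) (z : Fin n → ℂ) :
    symDensity n t a b d c z = symDensity n t a b c d z := by
  simp only [symDensity_eq, koornwinderWeight_swap]

theorem koornwinderWeight_mul_cFactor {a b c d x : ℂ} (ha : ‖a‖ < 1) (hb : ‖b‖ < 1)
    (hx : ‖x‖ = 1) :
    koornwinderWeight a b c d x * cFactor a b x⁻¹ = halfWeight a b c d x := by
  have hx0 : x ≠ 0 := fun h => by simp [h] at hx
  unfold koornwinderWeight cFactor halfWeight
  by_cases h : 1 - x⁻¹ ^ 2 = 0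
  · have : 1 - x ^ 2 = 0 := by
      field_simp at h
      linear_combination -h
    simp [this]
  · have h1 := one_sub_mul_ne_zero (x := x⁻¹) ha (by simp [hx])
    have h2 := one_sub_mul_ne_zero (x := x⁻¹) hb (by simp [hx])
    rw [div_mul_div_comm,
      ← mul_div_mul_left (1 - x ^ 2) _ (mul_ne_zero h (mul_ne_zero h1 h2))]
    congr 1 <;> ring

theorem pairWeight_mul_cPair {t x y : ℂ} (ht : ‖t‖ < 1) (hx : ‖x‖ = 1) (hy : ‖y‖ = 1) :
    pairWeight t x y * cPair t x⁻¹ y = halfPair t x y := by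
  have hx0 : x ≠ 0 := fun h => by simp [h] at hx
  have hy0 : y ≠ 0 := fun h => by simp [h] at hy
  unfold pairWeight cPair halfPair
  by_cases h : (1 - x⁻¹ * y) * (1 - x⁻¹ * y⁻¹) = 0
  · have : (1 - x * y) * (1 - x * y⁻¹) = 0 := by
      field_simp at h ⊢
      linear_combination h
    simp [this]
  · have h1 : 1 - t * x⁻¹ * y ≠ 0 := by
      rw [mul_assoc]; exact one_sub_mul_ne_zero ht (by simp [hx, hy])
    have h2 : 1 - t * x⁻¹ * y⁻¹ ≠ 0 := by
      rw [mul_assoc]; exact one_sub_mul_ne_zero ht (by simp [hx, hy])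
    rw [div_mul_div_comm,
      ← mul_div_mul_left ((1 - x * y) * _) _ (mul_ne_zero h (mul_ne_zero h1 h2))]
    congr 1 <;> ring

theorem symDensity_succAbove (n : ℕ) (t a b c d : ℂ) (z : Fin (n + 1) → ℂ) (k : Fin (n + 1)) :
    symDensity (n + 1) t a b c d z = (2 * (n + 1 : ℂ))⁻¹ *
      (koornwinderWeight a b c d (z k) * ∏ j, pairWeight t (z k) (z (k.succAbove j))) *
      symDensity n t a b c d fun j => z (k.succAbove j) := by
  have hpair : (∏ i, ∏ j, if i < j then pairWeight t (z i) (z j) else 1) =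
      (∏ j, pairWeight t (z k) (z (k.succAbove j))) *
        ∏ i, ∏ j, if i < j then pairWeight t (z (k.succAbove i)) (z (k.succAbove j)) else 1 := by
    rw [Fin.prod_univ_succAbove _ k, Fin.prod_univ_succAbove _ k, if_neg (lt_irrefl k), one_mul]
    simp only [Fin.prod_univ_succAbove _ k, Finset.prod_mul_distrib, Fin.succAbove_lt_succAbove_iff]
    rw [← mul_assoc, ← Finset.prod_mul_distrib]
    congr 1
    refine Finset.prod_congr rfl fun j _ => ?_
    rcases lt_or_gt_of_ne (Fin.succAbove_ne k j) with h | h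
    · rw [if_neg h.asymm, if_pos h, one_mul, pairWeight_comm]
    · rw [if_pos h, if_neg h.asymm, mul_one]
  rw [symDensity_eq, symDensity_eq, hpair, Fin.prod_univ_succAbove _ k, Nat.factorial_succ]
  push_cast
  rw [pow_succ]
  simp only [mul_inv]
  ring

/-- A summand of the symmetrized density: `x` is the variable to be integrated by
Cauchy's formula. -/
noncomputable def reducedDensity (n : ℕ) (t a b c d x : ℂ) (w : Fin n → ℂ) : ℂ :=
  (2 * (n + 1 : ℂ))⁻¹ * (halfWeight a b c d x * ∏ j, halfPair t x (w j)) *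
    symDensity n t a b c d w

theorem symDensity_mul_cFactor {n : ℕ} {t a b c d : ℂ} (ha : ‖a‖ < 1) (hb : ‖b‖ < 1)
    (ht : ‖t‖ < 1) {z : Fin (n + 1) → ℂ} (hz : ∀ i, ‖z i‖ = 1) (k : Fin (n + 1)) :
    symDensity (n + 1) t a b c d z *
        (cFactor a b (z k)⁻¹ * ∏ j, cPair t (z k)⁻¹ (z (k.succAbove j))) =
      reducedDensity n t a b c d (z k) fun j => z (k.succAbove j) := by
  rw [symDensity_succAbove n t a b c d z k, reducedDensity,
    ← koornwinderWeight_mul_cFactor ha hb (hz k)]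
  simp only [← pairWeight_mul_cPair ht (hz _) (hz _), Finset.prod_mul_distrib]
  ring

theorem symDensity_mul_cFactor_inv {n : ℕ} {t a b c d : ℂ} (ha : ‖a‖ < 1) (hb : ‖b‖ < 1)
    (ht : ‖t‖ < 1) {z : Fin (n + 1) → ℂ} (hz : ∀ i, ‖z i‖ = 1) (k : Fin (n + 1)) :
    symDensity (n + 1) t a b c d z *
        (cFactor a b (z k) * ∏ j, cPair t (z k) (z (k.succAbove j))) =
      reducedDensity n t a b c d (z k)⁻¹ fun j => z (k.succAbove j) := by
  have hk : ‖(z k)⁻¹‖ = 1 := by simp [hz]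
  rw [symDensity_succAbove n t a b c d z k, reducedDensity,
    ← koornwinderWeight_mul_cFactor ha hb hk]
  simp only [← pairWeight_mul_cPair ht hk (hz _), Finset.prod_mul_distrib, inv_inv,
    koornwinderWeight_inv, pairWeight_inv_left]
  ring

theorem symDensity_eq_sum_reducedDensity {n : ℕ} {t a b c d : ℂ} (ha : ‖a‖ < 1) (hb : ‖b‖ < 1)
    (ht : ‖t‖ < 1) {z : Fin (n + 1) → ℂ} (hz : ∀ i, ‖z i‖ = 1) :
    (1 - t ^ (n + 1)) * (1 - t ^ n * a * b) * symDensity (n + 1) t a b c d z =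
      (1 - t) * ∑ k, (reducedDensity n t a b c d (z k) (fun j => z (k.succAbove j)) +
        reducedDensity n t a b c d (z k)⁻¹ fun j => z (k.succAbove j)) := by
  simp only [← symDensity_mul_cFactor ha hb ht hz, ← symDensity_mul_cFactor_inv ha hb ht hz,
    ← mul_add, ← Finset.mul_sum]
  by_cases h : symDensity (n + 1) t a b c d z = 0
  · simp [h]
  have hfac : ∀ k, koornwinderWeight a b c d (z k) ≠ 0 ∧
      ∀ j, pairWeight t (z k) (z (k.succAbove j)) ≠ 0 := by
    intro k
    rw [symDensity_succAbove n t a b c d z k] at h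
    have h' := right_ne_zero_of_mul (left_ne_zero_of_mul h)
    exact ⟨left_ne_zero_of_mul h',
      fun j => Finset.prod_ne_zero_iff.1 (right_ne_zero_of_mul h') j (Finset.mem_univ j)⟩
  have hz0 : ∀ i, z i ≠ 0 := fun i h => by simpa [h] using hz i
  rw [← sum_cFactor n a b t ht z hz]
  · ring
  · intro i hi
    exact (hfac i).1 (by simp [koornwinderWeight, hi])
  · intro i j hij
    obtain ⟨j, rfl⟩ := Fin.exists_succAbove_eq hij.symm
    constructor
    · intro h
      refine (hfac i).2 j ?_
      simp [pairWeight, ← h, hz0 i]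
    · intro h
      exact (hfac i).2 j (by simp [pairWeight, h])

/-- The part of `reducedDensity` holomorphic in `x` on the closed unit disc. -/
noncomputable def innerFactor {n : ℕ} (t a b c d x : ℂ) (w : Fin n → ℂ) : ℂ :=
  (1 - x ^ 2) / ((1 - a * x) * (1 - b * x) * (1 - c * x) * (1 - d * x)) * ∏ j, halfPair t x (w j)

theorem innerFactor_swap {n : ℕ} (t a b c d x : ℂ) (w : Fin n → ℂ) :
    innerFactor t a b d c x w = innerFactor t a b c d x w := by
  unfold innerFactor
  congr 2
  ring

open Real in
theorem circleAverage_halfWeight {n : ℕ} {t a b c d : ℂ} (ha : ‖a‖ < 1) (hb : ‖b‖ < 1)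
    (hc : ‖c‖ < 1) (hd : ‖d‖ < 1) (ht : ‖t‖ < 1) (hcd : c ≠ d) {w : Fin n → ℂ}
    (hw : ∀ j, ‖w j‖ = 1) :
    circleAverage (fun x => halfWeight a b c d x * ∏ j, halfPair t x (w j)) 0 1 =
      (c - d)⁻¹ * (c * innerFactor t a b c d c w - d * innerFactor t a b c d d w) := by
  have hdiff : DifferentiableOn ℂ (fun x => innerFactor t a b c d x w) (Metric.closedBall 0 1) := by
    unfold innerFactor halfPair
    have hlin : ∀ {s : ℂ}, ‖s‖ < 1 → ∀ x ∈ Metric.closedBall (0 : ℂ) 1, 1 - s * x ≠ 0 :=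
      fun hs x hx => one_sub_mul_ne_zero hs (by simpa using hx)
    refine DifferentiableOn.mul (DifferentiableOn.div (by fun_prop) (by fun_prop) fun x hx => ?_) ?_
    · exact mul_ne_zero (mul_ne_zero (mul_ne_zero (hlin ha x hx) (hlin hb x hx)) (hlin hc x hx))
        (hlin hd x hx)
    · refine DifferentiableOn.fun_finsetProd fun j _ => ?_
      refine DifferentiableOn.div (by fun_prop) (by fun_prop) fun x hx => mul_ne_zero ?_ ?_
      · rw [mul_right_comm]
        exact hlin (by simpa [hw] using ht) x hx
      · rw [mul_right_comm]
        exact hlin (by simpa [hw] using ht) x hx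
  have hcl : DiffContOnCl ℂ (fun x => innerFactor t a b c d x w) (Metric.ball 0 |(1 : ℝ)|) := by
    rw [abs_one]
    exact hdiff.diffContOnCl_ball subset_rfl
  have hcauchy : ∀ s : ℂ, ‖s‖ < 1 →
      circleAverage (fun x => ((x - 0) / (x - s)) • innerFactor t a b c d x w) 0 1 =
        innerFactor t a b c d s w :=
    fun s hs => hcl.circleAverage_smul_div (by simpa using hs)
  have hne : ∀ s : ℂ, ‖s‖ < 1 → ∀ x ∈ Metric.sphere (0 : ℂ) |(1 : ℝ)|, x - s ≠ 0 := by
    intro s hs x hx h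
    rw [sub_eq_zero.1 h] at hx
    simp at hx
    exact hs.ne hx
  have hint : ∀ s : ℂ, ‖s‖ < 1 → CircleIntegrable
      (fun x => s • (((x - 0) / (x - s)) • innerFactor t a b c d x w)) 0 1 := by
    intro s hs
    refine ContinuousOn.circleIntegrable' ?_
    simp only [smul_eq_mul]
    have hquot : ContinuousOn (fun x : ℂ => (x - 0) / (x - s)) (Metric.sphere 0 |(1 : ℝ)|) :=
      ContinuousOn.div (by fun_prop) (by fun_prop) (hne s hs)
    have hinner : ContinuousOn (fun x => innerFactor t a b c d x w) (Metric.sphere 0 |(1 : ℝ)|) :=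
      hdiff.continuousOn.mono (by rw [abs_one]; exact Metric.sphere_subset_closedBall)
    exact continuousOn_const.mul (hquot.mul hinner)
  have hsplit : Set.EqOn (fun x => halfWeight a b c d x * ∏ j, halfPair t x (w j))
      (fun x => (c - d)⁻¹ • (c • (((x - 0) / (x - c)) • innerFactor t a b c d x w) -
        d • (((x - 0) / (x - d)) • innerFactor t a b c d x w))) (Metric.sphere 0 |(1 : ℝ)|) := by
    intro x hx
    have hxc := hne c hc x hx
    have hxd := hne d hd x hx
    have hx0 : x ≠ 0 := by simpa using hne 0 (by simp) x hx
    have hcd' := sub_ne_zero.2 hcd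
    have h1 : 1 - c * x⁻¹ = (x - c) / x := by field_simp
    have h2 : 1 - d * x⁻¹ = (x - d) / x := by field_simp
    have hhw : halfWeight a b c d x =
        (x ^ 2 / ((x - c) * (x - d))) *
          ((1 - x ^ 2) / ((1 - a * x) * (1 - b * x) * (1 - c * x) * (1 - d * x))) := by
      rw [halfWeight, h1, h2, div_mul_div_comm,
        ← mul_div_mul_left (1 - x ^ 2) _ (pow_ne_zero 2 hx0)]
      congr 1
      field_simp
    have hpf : x ^ 2 / ((x - c) * (x - d)) =
        (c - d)⁻¹ * (c * ((x - 0) / (x - c)) - d * ((x - 0) / (x - d))) := by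
      field_simp
      ring
    simp only [smul_eq_mul]
    rw [hhw, mul_assoc, ← innerFactor, hpf]
    ring
  rw [circleAverage_congr_sphere hsplit, circleAverage_fun_smul]
  have hsub := circleAverage_fun_sub (hint c hc) (hint d hd)
  rw [circleAverage_fun_smul, circleAverage_fun_smul] at hsub
  rw [hcauchy c hc, hcauchy d hd] at hsub
  exact congrArg _ hsub

theorem innerFactor_mul_symDensity {n : ℕ} {t a b c d : ℂ} (hc : ‖c‖ < 1)
    {w : Fin n → ℂ} (hw : ∀ j, ‖w j‖ = 1) :
    innerFactor t a b c d c w * symDensity n t a b c d w =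
      ((1 - a * c) * (1 - b * c) * (1 - c * d))⁻¹ * symDensity n t a b (t * c) d w := by
  have hcc : 1 - c * c ≠ 0 := one_sub_mul_ne_zero hc hc.le
  have hprod : (∏ j, halfPair t c (w j)) * ∏ j, koornwinderWeight a b c d (w j) =
      ∏ j, koornwinderWeight a b (t * c) d (w j) := by
    rw [← Finset.prod_mul_distrib]
    refine Finset.prod_congr rfl fun j _ => ?_
    have h1 := one_sub_mul_ne_zero hc (hw j).le
    have h2 : 1 - c * (w j)⁻¹ ≠ 0 := one_sub_mul_ne_zero hc (by simp [hw])
    unfold halfPair koornwinderWeight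
    rw [div_mul_div_comm, ← mul_div_mul_left (_ * (1 - (w j)⁻¹ ^ 2)) _ (mul_ne_zero h1 h2)]
    congr 1
    ring
  have hlead : (1 - c ^ 2) / ((1 - a * c) * (1 - b * c) * (1 - c * c) * (1 - d * c)) =
      ((1 - a * c) * (1 - b * c) * (1 - c * d))⁻¹ := by
    rw [← mul_one (((1 - a * c) * (1 - b * c) * (1 - c * d))⁻¹), ← div_eq_inv_mul,
      ← mul_div_mul_left 1 _ hcc]
    congr 1 <;> ring
  rw [symDensity_eq, symDensity_eq, innerFactor, ← hprod, hlead]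
  ring

theorem continuous_symDensity {X : Type*} [TopologicalSpace X] {n : ℕ} {t a b c : ℂ} {d : X → ℂ}
    {z : X → Fin n → ℂ} (ha : ‖a‖ < 1) (hb : ‖b‖ < 1) (hc : ‖c‖ < 1) (ht : ‖t‖ < 1)
    (hd : ∀ x, ‖d x‖ < 1) (hdc : Continuous d) (hz : ∀ x i, ‖z x i‖ = 1) (hzc : Continuous z) :
    Continuous fun x => symDensity n t a b c (d x) (z x) := by
  have hz0 : ∀ x i, z x i ≠ 0 := fun x i h => by simpa [h] using hz x i
  have hzi : ∀ i, Continuous fun x => z x i := fun i => (continuous_apply i).comp hzc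
  have hzinv : ∀ i, Continuous fun x => (z x i)⁻¹ := fun i => (hzi i).inv₀ fun x => hz0 x i
  have h1 : ∀ {s : ℂ}, ‖s‖ < 1 → ∀ x i, 1 - s * z x i ≠ 0 :=
    fun hs x i => one_sub_mul_ne_zero hs (hz x i).le
  have h2 : ∀ {s : ℂ}, ‖s‖ < 1 → ∀ x i, 1 - s * (z x i)⁻¹ ≠ 0 :=
    fun hs x i => one_sub_mul_ne_zero hs (by simp [hz])
  simp only [symDensity_eq, koornwinderWeight, pairWeight]
  refine (continuous_const.mul (continuous_finsetProd _ fun i _ => ?_)).mul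
    (continuous_finsetProd _ fun i _ => continuous_finsetProd _ fun j _ => ?_)
  · refine Continuous.div (by fun_prop) (by fun_prop) fun x => ?_
    simp only [mul_ne_zero_iff]
    exact ⟨⟨⟨⟨⟨⟨⟨h1 ha x i, h2 ha x i⟩, h1 hb x i⟩, h2 hb x i⟩, h1 hc x i⟩, h2 hc x i⟩,
      h1 (hd x) x i⟩, h2 (hd x) x i⟩
  · split_ifs
    · refine Continuous.div (by fun_prop) (by fun_prop) fun x => ?_
      simp only [mul_ne_zero_iff]
      refine ⟨⟨⟨?_, ?_⟩, ?_⟩, ?_⟩ <;>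
        (rw [mul_assoc]; exact one_sub_mul_ne_zero ht (by simp [hz]))
    · exact continuous_const

theorem continuous_reducedDensity {X : Type*} [TopologicalSpace X] {n : ℕ} {t a b c d : ℂ}
    {u : X → ℂ} {w : X → Fin n → ℂ} (ha : ‖a‖ < 1) (hb : ‖b‖ < 1) (hc : ‖c‖ < 1) (hd : ‖d‖ < 1)
    (ht : ‖t‖ < 1) (hu : ∀ x, ‖u x‖ = 1) (huc : Continuous u) (hw : ∀ x i, ‖w x i‖ = 1)
    (hwc : Continuous w) :
    Continuous fun x => reducedDensity n t a b c d (u x) (w x) := by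
  have huinv : Continuous fun x => (u x)⁻¹ := huc.inv₀ fun x h => by simpa [h] using hu x
  have hwi : ∀ i, Continuous fun x => w x i := fun i => (continuous_apply i).comp hwc
  have hwinv : ∀ i, Continuous fun x => (w x i)⁻¹ :=
    fun i => (hwi i).inv₀ fun x h => by simpa [h] using hw x i
  have h1 : ∀ {s : ℂ}, ‖s‖ < 1 → ∀ x, 1 - s * u x ≠ 0 :=
    fun hs x => one_sub_mul_ne_zero hs (hu x).le
  have h2 : ∀ {s : ℂ}, ‖s‖ < 1 → ∀ x, 1 - s * (u x)⁻¹ ≠ 0 :=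
    fun hs x => one_sub_mul_ne_zero hs (by simp [hu])
  unfold reducedDensity halfWeight halfPair
  refine (continuous_const.mul (Continuous.mul ?_ (continuous_finsetProd _ fun j _ => ?_))).mul
    (continuous_symDensity ha hb hc ht (fun _ => hd) continuous_const hw hwc)
  · refine Continuous.div (by fun_prop) (by fun_prop) fun x => ?_
    simp only [mul_ne_zero_iff]
    exact ⟨⟨⟨⟨⟨h1 ha x, h1 hb x⟩, h1 hc x⟩, h2 hc x⟩, h1 hd x⟩, h2 hd x⟩
  · refine Continuous.div (by fun_prop) (by fun_prop) fun x => mul_ne_zero ?_ ?_ <;>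
      (rw [mul_assoc]; exact one_sub_mul_ne_zero ht (by simp [hu, hw]))

open Real in
theorem torusInt_circleAverage_reducedDensity {n : ℕ} {t a b c d : ℂ} (ha : ‖a‖ < 1)
    (hb : ‖b‖ < 1) (hc : ‖c‖ < 1) (hd : ‖d‖ < 1) (ht : ‖t‖ < 1) (hcd : c ≠ d) :
    torusInt n (fun w => circleAverage (fun x => reducedDensity n t a b c d x w) 0 1) =
      (2 * (n + 1 : ℂ))⁻¹ * (c - d)⁻¹ *
        (c * ((1 - a * c) * (1 - b * c) * (1 - c * d))⁻¹ *
            torusInt n (symDensity n t a b (t * c) d) -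
          d * ((1 - a * d) * (1 - b * d) * (1 - c * d))⁻¹ *
            torusInt n (symDensity n t a b c (t * d))) := by
  have hmul : ∀ {s : ℂ}, ‖s‖ < 1 → ‖t * s‖ < 1 := fun hs => by
    rw [norm_mul]; exact mul_lt_one_of_nonneg_of_lt_one_left (norm_nonneg _) ht hs.le
  have hpoint : ∀ w : Fin n → ℂ, (∀ i, ‖w i‖ = 1) →
      circleAverage (fun x => reducedDensity n t a b c d x w) 0 1 =
        (2 * (n + 1 : ℂ))⁻¹ * (c - d)⁻¹ * (c * ((1 - a * c) * (1 - b * c) * (1 - c * d))⁻¹) *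
            symDensity n t a b (t * c) d w +
          -((2 * (n + 1 : ℂ))⁻¹ * (c - d)⁻¹ * (d * ((1 - a * d) * (1 - b * d) * (1 - c * d))⁻¹)) *
            symDensity n t a b c (t * d) w := by
    intro w hw
    have hfun : (fun x => reducedDensity n t a b c d x w) = fun x =>
        ((2 * (n + 1 : ℂ))⁻¹ * symDensity n t a b c d w) •
          (halfWeight a b c d x * ∏ j, halfPair t x (w j)) := by
      funext x
      rw [reducedDensity, smul_eq_mul]
      ring
    have h1 := innerFactor_mul_symDensity (t := t) (a := a) (b := b) (d := d) hc hw
    have h2 := innerFactor_mul_symDensity (t := t) (a := a) (b := b) (d := c) hd hw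
    rw [innerFactor_swap, symDensity_swap n t a b c d, symDensity_swap n t a b c (t * d),
      mul_comm d c] at h2
    rw [hfun, circleAverage_fun_smul, circleAverage_halfWeight ha hb hc hd ht hcd hw, smul_eq_mul]
    linear_combination (2 * (n + 1 : ℂ))⁻¹ * (c - d)⁻¹ * c * h1 -
      (2 * (n + 1 : ℂ))⁻¹ * (c - d)⁻¹ * d * h2
  rw [torusInt_congr hpoint, torusInt_add, torusInt_const_mul, torusInt_const_mul]
  · ring
  · exact continuous_const.mul (continuous_symDensity ha hb (hmul hc) ht (fun _ => hd)
      continuous_const norm_expTorus continuous_expTorus)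
  · exact continuous_const.mul (continuous_symDensity ha hb hc ht (fun _ => hmul hd)
      continuous_const norm_expTorus continuous_expTorus)

open Real in
theorem torusInt_symDensity_succ {n : ℕ} {t a b c d : ℂ} (ha : ‖a‖ < 1) (hb : ‖b‖ < 1)
    (hc : ‖c‖ < 1) (hd : ‖d‖ < 1) (ht : ‖t‖ < 1) (hcd : c ≠ d) :
    (1 - t ^ (n + 1)) * (1 - t ^ n * a * b) * torusInt (n + 1) (symDensity (n + 1) t a b c d) =
      (1 - t) * (c - d)⁻¹ *
        (c * ((1 - a * c) * (1 - b * c) * (1 - c * d))⁻¹ *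
            torusInt n (symDensity n t a b (t * c) d) -
          d * ((1 - a * d) * (1 - b * d) * (1 - c * d))⁻¹ *
            torusInt n (symDensity n t a b c (t * d))) := by
  have hcont : ∀ k : Fin (n + 1), Continuous fun θ =>
      reducedDensity n t a b c d (expTorus θ k) (fun j => expTorus θ (k.succAbove j)) :=
    fun k => continuous_reducedDensity ha hb hc hd ht (fun θ => norm_expTorus θ k)
      (by fun_prop) (fun θ j => norm_expTorus θ _) (by fun_prop)
  have hcont' : ∀ k : Fin (n + 1), Continuous fun θ =>
      reducedDensity n t a b c d (expTorus θ k)⁻¹ (fun j => expTorus θ (k.succAbove j)) :=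
    fun k => continuous_reducedDensity ha hb hc hd ht (fun θ => by simp [norm_expTorus])
      (Continuous.inv₀ (by fun_prop) fun θ h => by simpa [h] using norm_expTorus θ k)
      (fun θ j => norm_expTorus θ _) (by fun_prop)
  have hk : ∀ k : Fin (n + 1), torusInt (n + 1) (fun z =>
      reducedDensity n t a b c d (z k) (fun j => z (k.succAbove j)) +
        reducedDensity n t a b c d (z k)⁻¹ fun j => z (k.succAbove j)) =
      2 * torusInt n fun w => circleAverage (fun x => reducedDensity n t a b c d x w) 0 1 := by
    intro k
    rw [torusInt_add (hcont k) (hcont' k), torusInt_succAbove k _ (hcont k),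
      torusInt_succAbove k _ (hcont' k), two_mul]
    simp only [Fin.insertNth_apply_same, Fin.insertNth_apply_succAbove]
    congr 2
    funext w
    exact circleAverage_zero_one_congr_inv (f := fun x => reducedDensity n t a b c d x w)
  rw [← torusInt_const_mul,
    torusInt_congr fun z hz => symDensity_eq_sum_reducedDensity ha hb ht hz,
    torusInt_const_mul, torusInt_sum fun k => (hcont k).add (hcont' k)]
  simp only [hk, torusInt_circleAverage_reducedDensity ha hb hc hd ht hcd, Finset.sum_const,
    Finset.card_univ, Fintype.card_fin, nsmul_eq_mul]
  have hn : (n + 1 : ℂ) ≠ 0 := by exact_mod_cast n.succ_ne_zero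
  push_cast
  field_simp

/-- The product side of Gustafson's evaluation at `q = 0`. -/
noncomputable def constantTerm (n : ℕ) (t a b c d : ℂ) : ℂ :=
  (∏ i ∈ Finset.range n,
    ((1 - t ^ i * a * c) * (1 - t ^ i * b * c) * (1 - t ^ i * c * d) *
     (1 - t ^ i * a * d) * (1 - t ^ i * b * d) * (1 - t ^ i * a * b)))⁻¹ *
  (∏ j ∈ Finset.range n, (1 - t ^ (2 * n - 2 - j) * a * b * c * d)) *
  ∏ j ∈ Finset.range n, (1 - t) / (1 - t ^ (j + 1))

theorem one_sub_pow_mul_ne_zero {t x y : ℂ} (ht : ‖t‖ < 1) (hx : ‖x‖ < 1) (hy : ‖y‖ < 1)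
    (i : ℕ) : 1 - t ^ i * x * y ≠ 0 := by
  refine one_sub_mul_ne_zero (s := t ^ i * x) ?_ hy.le
  rw [norm_mul, norm_pow]
  exact mul_lt_one_of_nonneg_of_lt_one_right (pow_le_one₀ (norm_nonneg _) ht.le) (norm_nonneg _) hx

theorem constantTerm_swap (n : ℕ) (t a b c d : ℂ) :
    constantTerm n t a b d c = constantTerm n t a b c d := by
  unfold constantTerm
  congr 2
  · congr 1
    exact Finset.prod_congr rfl fun i _ => by ring
  · exact Finset.prod_congr rfl fun i _ => by ring

theorem one_sub_pow_succ_ne_zero {t : ℂ} (ht : ‖t‖ < 1) (n : ℕ) : 1 - t ^ (n + 1) ≠ 0 := by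
  intro h
  have h1 : ‖t ^ (n + 1)‖ = 1 := by rw [← sub_eq_zero.1 h, norm_one]
  rw [norm_pow] at h1
  exact (pow_lt_one₀ (norm_nonneg t) ht n.succ_ne_zero).ne h1

theorem constantTerm_succ_mul {n : ℕ} {t a b c d : ℂ} (ha : ‖a‖ < 1) (hb : ‖b‖ < 1)
    (hc : ‖c‖ < 1) (hd : ‖d‖ < 1) (ht : ‖t‖ < 1) :
    (1 - t ^ (n + 1)) * (1 - t ^ n * a * b) * (1 - t ^ n * a * d) * (1 - t ^ n * b * d) *
        constantTerm (n + 1) t a b c d =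
      (1 - t) * (1 - t ^ (2 * n) * a * b * c * d) *
        ((1 - a * c) * (1 - b * c) * (1 - c * d))⁻¹ * constantTerm n t a b (t * c) d := by
  have hshift : ∀ x y : ℂ, ∏ i ∈ Finset.range (n + 1), (1 - t ^ i * x * y) =
      (1 - x * y) * ∏ i ∈ Finset.range n, (1 - t ^ i * x * (t * y)) := by
    intro x y
    rw [Finset.prod_range_succ', mul_comm, pow_zero, one_mul]
    exact congrArg _ (Finset.prod_congr rfl fun i _ => by ring)
  have hshift' : ∀ x y : ℂ, ∏ i ∈ Finset.range (n + 1), (1 - t ^ i * x * y) =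
      (1 - x * y) * ∏ i ∈ Finset.range n, (1 - t ^ i * (t * x) * y) := by
    intro x y
    rw [hshift]
    exact congrArg _ (Finset.prod_congr rfl fun i _ => by ring)
  have hnum : ∏ j ∈ Finset.range (n + 1), (1 - t ^ (2 * (n + 1) - 2 - j) * a * b * c * d) =
      (1 - t ^ (2 * n) * a * b * c * d) *
        ∏ j ∈ Finset.range n, (1 - t ^ (2 * n - 2 - j) * a * b * (t * c) * d) := by
    rw [Finset.prod_range_succ', mul_comm]
    congr 1
    refine Finset.prod_congr rfl fun j hj => ?_
    have hj := Finset.mem_range.1 hj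
    rw [show 2 * (n + 1) - 2 - (j + 1) = 2 * n - 2 - j + 1 by omega]
    ring
  have hP : ∀ {x y : ℂ}, ‖x‖ < 1 → ‖y‖ < 1 →
      ∏ i ∈ Finset.range n, (1 - t ^ i * x * y) ≠ 0 := fun hx hy =>
    Finset.prod_ne_zero_iff.2 fun i _ => one_sub_pow_mul_ne_zero ht hx hy i
  have h0 : ∀ {x y : ℂ}, ‖x‖ < 1 → ‖y‖ < 1 → 1 - x * y ≠ 0 := fun hx hy =>
    one_sub_mul_ne_zero hx hy.le
  have htc : ‖t * c‖ < 1 := by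
    rw [norm_mul]; exact mul_lt_one_of_nonneg_of_lt_one_left (norm_nonneg _) ht hc.le
  unfold constantTerm
  simp only [Finset.prod_mul_distrib]
  rw [hnum, hshift a c, hshift b c, hshift' c d, Finset.prod_range_succ _ n,
    Finset.prod_range_succ _ n, Finset.prod_range_succ _ n, Finset.prod_range_succ _ n]
  have e1 := one_sub_pow_succ_ne_zero ht n
  have e2 := one_sub_pow_mul_ne_zero ht ha hb n
  have e3 := one_sub_pow_mul_ne_zero ht ha hd n
  have e4 := one_sub_pow_mul_ne_zero ht hb hd n
  generalize ∏ j ∈ Finset.range n, (1 - t ^ (2 * n - 2 - j) * a * b * (t * c) * d) = N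
  generalize ∏ j ∈ Finset.range n, (1 - t) / (1 - t ^ (j + 1)) = T
  have p1 := hP ha htc
  have p2 := hP hb htc
  have p3 := hP htc hd
  have p4 := hP ha hd
  have p5 := hP hb hd
  have p6 := hP ha hb
  have q1 := h0 ha hc
  have q2 := h0 hb hc
  have q3 := h0 hc hd
  generalize ∏ i ∈ Finset.range n, (1 - t ^ i * a * (t * c)) = P₁ at p1 ⊢
  generalize ∏ i ∈ Finset.range n, (1 - t ^ i * b * (t * c)) = P₂ at p2 ⊢
  generalize ∏ i ∈ Finset.range n, (1 - t ^ i * (t * c) * d) = P₃ at p3 ⊢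
  generalize ∏ i ∈ Finset.range n, (1 - t ^ i * a * d) = P₄ at p4 ⊢
  generalize ∏ i ∈ Finset.range n, (1 - t ^ i * b * d) = P₅ at p5 ⊢
  generalize ∏ i ∈ Finset.range n, (1 - t ^ i * a * b) = P₆ at p6 ⊢
  generalize 1 - t ^ (2 * n) * a * b * c * d = M
  generalize 1 - t ^ (n + 1) = E₁ at e1 ⊢
  generalize 1 - t ^ n * a * b = E₂ at e2 ⊢
  generalize 1 - t ^ n * a * d = E₃ at e3 ⊢
  generalize 1 - t ^ n * b * d = E₄ at e4 ⊢
  generalize 1 - a * c = Q₁ at q1 ⊢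
  generalize 1 - b * c = Q₂ at q2 ⊢
  generalize 1 - c * d = Q₃ at q3 ⊢
  generalize 1 - t = R
  field_simp

theorem constantTerm_succ {n : ℕ} {t a b c d : ℂ} (ha : ‖a‖ < 1) (hb : ‖b‖ < 1)
    (hc : ‖c‖ < 1) (hd : ‖d‖ < 1) (ht : ‖t‖ < 1) (hcd : c ≠ d) :
    (1 - t ^ (n + 1)) * (1 - t ^ n * a * b) * constantTerm (n + 1) t a b c d =
      (1 - t) * (c - d)⁻¹ *
        (c * ((1 - a * c) * (1 - b * c) * (1 - c * d))⁻¹ * constantTerm n t a b (t * c) d -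
          d * ((1 - a * d) * (1 - b * d) * (1 - c * d))⁻¹ * constantTerm n t a b c (t * d)) := by
  have h1 := constantTerm_succ_mul (n := n) ha hb hc hd ht
  have h2 := constantTerm_succ_mul (n := n) ha hb hd hc ht
  rw [constantTerm_swap (n + 1) t a b c d, constantTerm_swap n t a b c (t * d), mul_comm d c,
    show t ^ (2 * n) * a * b * d * c = t ^ (2 * n) * a * b * c * d by ring] at h2
  have hM : 1 - t ^ (2 * n) * a * b * c * d ≠ 0 := by
    have hmul : ∀ {x y : ℂ}, ‖x‖ < 1 → ‖y‖ < 1 → ‖x * y‖ < 1 := fun hx hy => by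
      rw [norm_mul]; exact mul_lt_one_of_nonneg_of_lt_one_left (norm_nonneg _) hx hy.le
    have := one_sub_pow_mul_ne_zero ht (hmul (hmul ha hb) hc) hd (2 * n)
    simpa only [← mul_assoc] using this
  have hsub := sub_ne_zero.2 hcd
  refine mul_left_cancel₀ (mul_ne_zero hM hsub) ?_
  have hpow : t ^ (2 * n) = t ^ n * t ^ n := by rw [two_mul, pow_add]
  have hinv : (c - d) * (c - d)⁻¹ = 1 := mul_inv_cancel₀ hsub
  generalize ((1 - a * c) * (1 - b * c) * (1 - c * d))⁻¹ = I₁ at h1 ⊢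
  generalize ((1 - a * d) * (1 - b * d) * (1 - c * d))⁻¹ = I₂ at h2 ⊢
  generalize constantTerm (n + 1) t a b c d = C at h1 h2 ⊢
  generalize constantTerm n t a b (t * c) d = C₁ at h1 ⊢
  generalize constantTerm n t a b c (t * d) = C₂ at h2 ⊢
  generalize (c - d)⁻¹ = J at hinv ⊢
  generalize t ^ (n + 1) = U at h1 h2 ⊢
  rw [hpow] at h1 h2 ⊢
  generalize t ^ n = V at h1 h2 ⊢
  linear_combination c * h1 - d * h2 - (1 - V * V * a * b * c * d) * (1 - t) *
    (c * I₁ * C₁ - d * I₂ * C₂) * hinv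

theorem continuous_constantTerm {X : Type*} [TopologicalSpace X] (n : ℕ) {t a b c : ℂ} {d : X → ℂ}
    (ha : ‖a‖ < 1) (hb : ‖b‖ < 1) (hc : ‖c‖ < 1) (ht : ‖t‖ < 1) (hd : ∀ x, ‖d x‖ < 1)
    (hdc : Continuous d) : Continuous fun x => constantTerm n t a b c (d x) := by
  unfold constantTerm
  refine ((Continuous.inv₀ (by fun_prop) fun x => ?_).mul (by fun_prop)).mul (by fun_prop)
  refine Finset.prod_ne_zero_iff.2 fun i _ => ?_
  simp only [mul_ne_zero_iff]
  exact ⟨⟨⟨⟨⟨one_sub_pow_mul_ne_zero ht ha hc i, one_sub_pow_mul_ne_zero ht hb hc i⟩,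
    one_sub_pow_mul_ne_zero ht hc (hd x) i⟩, one_sub_pow_mul_ne_zero ht ha (hd x) i⟩,
    one_sub_pow_mul_ne_zero ht hb (hd x) i⟩, one_sub_pow_mul_ne_zero ht ha hb i⟩

theorem torusInt_symDensity_of_ne {n : ℕ} {t a b c : ℂ} (ha : ‖a‖ < 1) (hb : ‖b‖ < 1)
    (hc : ‖c‖ < 1) (ht : ‖t‖ < 1)
    (h : ∀ d, ‖d‖ < 1 → c ≠ d → torusInt n (symDensity n t a b c d) = constantTerm n t a b c d) :
    torusInt n (symDensity n t a b c c) = constantTerm n t a b c c := by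
  have hopen : IsOpen (Metric.ball (0 : ℂ) 1) := Metric.isOpen_ball
  have : LocallyCompactSpace (Metric.ball (0 : ℂ) 1) := hopen.locallyCompactSpace
  have hnorm : ∀ x : Metric.ball (0 : ℂ) 1, ‖(x : ℂ)‖ < 1 := fun x => mem_ball_zero_iff.1 x.2
  have hleft : ContinuousOn (fun d => torusInt n (symDensity n t a b c d)) (Metric.ball 0 1) := by
    rw [continuousOn_iff_continuous_domRestrict]
    exact continuous_torusInt (f := fun x : Metric.ball (0 : ℂ) 1 => symDensity n t a b c x)
      (continuous_symDensity ha hb hc ht (fun p => hnorm p.1) (by fun_prop)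
        (fun p i => norm_expTorus p.2 i) (continuous_expTorus.comp continuous_snd))
  have hright : ContinuousOn (constantTerm n t a b c) (Metric.ball 0 1) := by
    rw [continuousOn_iff_continuous_domRestrict]
    exact continuous_constantTerm n ha hb hc ht hnorm continuous_subtype_val
  have hmem : Metric.ball (0 : ℂ) 1 ∈ nhds c := hopen.mem_nhds (by simpa using hc)
  refine tendsto_nhds_unique_of_eventuallyEq
    ((hleft.continuousAt hmem).tendsto.mono_left nhdsWithin_le_nhds)
    ((hright.continuousAt hmem).tendsto.mono_left (nhdsWithin_le_nhds (s := {c}ᶜ))) ?_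
  filter_upwards [self_mem_nhdsWithin, nhdsWithin_le_nhds hmem] with d hdc hd
  exact h d (by simpa using hd) (Ne.symm hdc)

theorem torusInt_symDensity {n : ℕ} {t a b c d : ℂ} (ha : ‖a‖ < 1) (hb : ‖b‖ < 1)
    (hc : ‖c‖ < 1) (hd : ‖d‖ < 1) (ht : ‖t‖ < 1) :
    torusInt n (symDensity n t a b c d) = constantTerm n t a b c d := by
  induction n generalizing c d with
  | zero => simp [torusInt, symDensity, constantTerm, Measure.real]
  | succ n ih =>
    have hmul : ∀ {s : ℂ}, ‖s‖ < 1 → ‖t * s‖ < 1 := fun hs => by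
      rw [norm_mul]; exact mul_lt_one_of_nonneg_of_lt_one_left (norm_nonneg _) ht hs.le
    have hne : ∀ d, ‖d‖ < 1 → c ≠ d →
        torusInt (n + 1) (symDensity (n + 1) t a b c d) = constantTerm (n + 1) t a b c d := by
      intro d hd hcd
      refine mul_left_cancel₀ (mul_ne_zero (one_sub_pow_succ_ne_zero ht n)
        (one_sub_pow_mul_ne_zero ht ha hb n)) ?_
      rw [torusInt_symDensity_succ ha hb hc hd ht hcd, constantTerm_succ ha hb hc hd ht hcd,
        ih (hmul hc) hd, ih hc (hmul hd)]
    rcases eq_or_ne c d with rfl | hcd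
    · exact torusInt_symDensity_of_ne ha hb hc ht hne
    · exact hne d hd hcd

/-- Gustafson's constant term evaluation at `q = 0`:
the constant term of the symmetric Koornwinder density equals
`∏_{i=0}^{n−1} [(1−tⁱac)(1−tⁱbc)(1−tⁱcd)(1−tⁱad)(1−tⁱbd)(1−tⁱab)]⁻¹
 · ∏_{j=0}^{n−1}(1−t^{2n−2−j}abcd) · ∏_{j=1}^{n}(1−t)/(1−tʲ)`. -/
theorem symmetric_constant_term (n : ℕ) (t a b c d : ℂ)
    (ha : ‖a‖ < 1) (hb : ‖b‖ < 1) (hc : ‖c‖ < 1) (hd : ‖d‖ < 1) (ht : ‖t‖ < 1) :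
    torusInt n (symDensity n t a b c d)
    = (∏ i ∈ Finset.range n,
        ((1 - t ^ i * a * c) * (1 - t ^ i * b * c) * (1 - t ^ i * c * d) *
         (1 - t ^ i * a * d) * (1 - t ^ i * b * d) * (1 - t ^ i * a * b)))⁻¹ *
      (∏ j ∈ Finset.range n, (1 - t ^ (2 * n - 2 - j) * a * b * c * d)) *
      ∏ j ∈ Finset.range n, (1 - t) / (1 - t ^ (j + 1)) := by
  exact torusInt_symDensity ha hb hc hd ht
end

section
/- The function K_λ^{(n)}(z;t;a,b;t₀,t₁,t₂,t₃) defined as (1/v_λ) ∑_{w∈B_n} w(∏_i u_λ(z_i) ∏_{i<j} (1−t z_i^{−1}z_j)(1−t z_i^{−1}z_j^{−1})/[(1−z_i^{−1}z_j)(1−z_i^{−1}z_j^{−1})]) is a Laurent polynomial in z₁,…,z_n invariant under all permutations of the variables and under inverting any variable z_i → z_i^{−1}. -/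
open Finset

/-- `lam` is a partition: weakly decreasing with nonnegative entries. -/
def isPartition {n : ℕ} (lam : Fin n → ℤ) : Prop :=
  (∀ i, 0 ≤ lam i) ∧ ∀ i j : Fin n, i ≤ j → lam j ≤ lam i

/-- Action of an element `(σ, ε)` of the hyperoctahedral group `B_n` on a point
`z ∈ (ℂ*)ⁿ`: permute the variables by `σ` and invert those with `ε i = true`. -/
noncomputable def bnAct {n : ℕ} (σ : Equiv.Perm (Fin n)) (ε : Fin n → Bool)
    (z : Fin n → ℂ) : Fin n → ℂ :=
  fun i => if ε i then (z (σ i))⁻¹ else z (σ i)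

/-- The univariate factor `u_λ(z_i)` of the `q = 0` Koornwinder kernel. -/
noncomputable def uLam (l : ℤ) (a b t0 t1 t2 t3 : ℂ) (x : ℂ) : ℂ :=
  if l = 0 then (1 - a * x⁻¹) * (1 - b * x⁻¹) / (1 - x⁻¹ ^ 2)
  else x ^ l * ((1 - t0 * x⁻¹) * (1 - t1 * x⁻¹) * (1 - t2 * x⁻¹) * (1 - t3 * x⁻¹)) /
    (1 - x⁻¹ ^ 2)

/-- The base term `∏_i u_λ(z_i) ∏_{i<j} (1−tz_i⁻¹z_j)(1−tz_i⁻¹z_j⁻¹)/[(1−z_i⁻¹z_j)(1−z_i⁻¹z_j⁻¹)]`. -/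
noncomputable def Rbase {n : ℕ} (lam : Fin n → ℤ) (t a b t0 t1 t2 t3 : ℂ)
    (y : Fin n → ℂ) : ℂ :=
  (∏ i : Fin n, uLam (lam i) a b t0 t1 t2 t3 (y i)) *
  ∏ i : Fin n, ∏ j : Fin n,
    if i < j then
      ((1 - t * (y i)⁻¹ * y j) * (1 - t * (y i)⁻¹ * (y j)⁻¹)) /
        ((1 - (y i)⁻¹ * y j) * (1 - (y i)⁻¹ * (y j)⁻¹))
    else 1

/-- The normalization constant `v_λ(t;a,b;t₀,…,t₃)`. -/
noncomputable def vlam {n : ℕ} (lam : Fin n → ℤ) (t a b t0 t1 t2 t3 : ℂ) : ℂ :=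
  (∏ p : Fin n,
      (1 - t ^ (Finset.univ.filter fun q : Fin n => lam q = lam p ∧ q ≤ p).card) / (1 - t)) *
  (∏ i ∈ Finset.range ((Finset.univ.filter fun q : Fin n => lam q = 1).card),
      (1 - t0 * t1 * t2 * t3 *
        t ^ (i + 2 * (Finset.univ.filter fun q : Fin n => lam q = 0).card))) *
  ∏ i ∈ Finset.range ((Finset.univ.filter fun q : Fin n => lam q = 0).card),
      (1 - a * b * t ^ i)

/-- The `q = 0` symmetric Koornwinder polynomial `K_λ^{(n)}(z;t;a,b;t₀,…,t₃)`,
defined as `v_λ⁻¹` times the sum over the hyperoctahedral group `B_n`. -/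
noncomputable def Kpoly {n : ℕ} (lam : Fin n → ℤ) (t a b t0 t1 t2 t3 : ℂ)
    (z : Fin n → ℂ) : ℂ :=
  (vlam lam t a b t0 t1 t2 t3)⁻¹ *
    ∑ σ : Equiv.Perm (Fin n), ∑ ε : Fin n → Bool,
      Rbase lam t a b t0 t1 t2 t3 (bnAct σ ε z)

/-- Genericity condition on `z`: all the denominators appearing in the terms of
`K_λ^{(n)}` are nonzero (for every element of `B_n`). -/
def genericZ {n : ℕ} (z : Fin n → ℂ) : Prop :=
  (∀ i, z i ≠ 0 ∧ z i ^ 2 ≠ 1) ∧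
    ∀ i j : Fin n, i ≠ j → z i * z j ≠ 1 ∧ z i ≠ z j

/-- The ring of Laurent polynomials in `n` variables. -/
abbrev LaurentRing (n : ℕ) := AddMonoidAlgebra ℂ (Fin n → ℤ)

/-- Evaluation of a Laurent polynomial at a point with nonzero coordinates. -/
noncomputable def laurentEval {n : ℕ} (z : Fin n → ℂ) (hz : ∀ i, z i ≠ 0) :
    LaurentRing n →ₐ[ℂ] ℂ :=
  AddMonoidAlgebra.lift ℂ ℂ (Fin n → ℤ)
    { toFun := fun μ => ∏ i, z i ^ (Multiplicative.toAdd μ) i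
      map_one' := by simp
      map_mul' := fun μ ν => by
        simp [← Finset.prod_mul_distrib, zpow_add₀ (hz _)] }

theorem laurentEval_apply {n : ℕ} (z : Fin n → ℂ) (hz : ∀ i, z i ≠ 0) (p : LaurentRing n) :
    laurentEval z hz p = ∑ μ ∈ p.coeff.support, p.coeff μ * ∏ i, z i ^ μ i := by
  simp [laurentEval, AddMonoidAlgebra.lift_apply, Finsupp.sum]

theorem laurentEval_single {n : ℕ} (z : Fin n → ℂ) (hz : ∀ i, z i ≠ 0) (μ : Fin n → ℤ) (c : ℂ) :
    laurentEval z hz (AddMonoidAlgebra.single μ c) = c * ∏ i, z i ^ μ i := by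
  simp [laurentEval]

/-- A function on `(ℂ*)ⁿ` is Laurent if it is the evaluation of a Laurent polynomial. -/
def IsLaurent {n : ℕ} (f : (Fin n → ℂ) → ℂ) : Prop :=
  ∃ p : LaurentRing n, ∀ z (hz : ∀ i, z i ≠ 0), f z = laurentEval z hz p

namespace IsLaurent

variable {n : ℕ} {f g : (Fin n → ℂ) → ℂ}

theorem const (c : ℂ) : IsLaurent (fun _ : Fin n → ℂ => c) :=
  ⟨algebraMap ℂ _ c, fun z hz => by simp only [AlgHom.commutes, Algebra.algebraMap_self_apply]⟩

theorem mul (hf : IsLaurent f) (hg : IsLaurent g) : IsLaurent (fun z => f z * g z) := by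
  obtain ⟨p, hp⟩ := hf
  obtain ⟨q, hq⟩ := hg
  exact ⟨p * q, fun z hz => by simp only [map_mul, hp z hz, hq z hz]⟩

theorem sub (hf : IsLaurent f) (hg : IsLaurent g) : IsLaurent (fun z => f z - g z) := by
  obtain ⟨p, hp⟩ := hf
  obtain ⟨q, hq⟩ := hg
  exact ⟨p - q, fun z hz => by simp only [map_sub, hp z hz, hq z hz]⟩

theorem prod {ι : Type*} (s : Finset ι) {F : ι → (Fin n → ℂ) → ℂ}
    (hF : ∀ i ∈ s, IsLaurent (F i)) : IsLaurent (fun z => ∏ i ∈ s, F i z) := by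
  classical
  induction s using Finset.induction_on with
  | empty => simpa using const (n := n) 1
  | insert i s hi ih =>
    simp only [Finset.prod_insert hi]
    exact (hF i (Finset.mem_insert_self i s)).mul
      (ih fun j hj => hF j (Finset.mem_insert_of_mem hj))

theorem zpow (i : Fin n) (m : ℤ) : IsLaurent (fun z : Fin n → ℂ => z i ^ m) := by
  refine ⟨AddMonoidAlgebra.single (Pi.single i m) 1, fun z hz => ?_⟩
  rw [laurentEval_single, one_mul, Finset.prod_eq_single i]
  · simp
  · intro j _ hj
    simp [Pi.single_eq_of_ne hj]
  · simp

theorem coord (i : Fin n) : IsLaurent (fun z : Fin n → ℂ => z i) := by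
  simpa using zpow i 1

theorem inv_coord (i : Fin n) : IsLaurent (fun z : Fin n → ℂ => (z i)⁻¹) := by
  simpa using zpow i (-1)

end IsLaurent

/-- An alternant of polynomials is divisible by the Vandermonde determinant. -/
theorem det_vandermonde_dvd_det_eval {R : Type*} [CommRing R] [Nontrivial R] {n : ℕ}
    (p : Fin n → Polynomial R) (x : Fin n → R) :
    (Matrix.vandermonde x).det ∣ (Matrix.of fun j i => (p i).eval (x j)).det := by
  set Q : Polynomial R := ∏ j, (Polynomial.X - Polynomial.C (x j)) with hQ
  have hmonic : Q.Monic := Polynomial.monic_prod_of_monic _ _ fun j _ =>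
    Polynomial.monic_X_sub_C (x j)
  have hdeg : Q.natDegree = n := by
    rw [hQ, Polynomial.natDegree_prod_of_monic _ _ fun j _ => Polynomial.monic_X_sub_C (x j)]
    simp
  have hroot : ∀ j, Q.eval (x j) = 0 := fun j => by
    rw [hQ, Polynomial.eval_prod]
    exact Finset.prod_eq_zero (Finset.mem_univ j) (by simp)
  have key : (Matrix.of fun j i => (p i).eval (x j)) =
      Matrix.vandermonde x * Matrix.of fun k i : Fin n => (p i %ₘ Q).coeff k := by
    ext j i
    have hlt : (p i %ₘ Q).natDegree < n := by
      have := Polynomial.natDegree_modByMonic_lt (p i) hmonic (fun h => by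
        have hn := j.pos
        rw [h, Polynomial.natDegree_one] at hdeg
        omega)
      rwa [hdeg] at this
    have heval : (p i).eval (x j) = (p i %ₘ Q).eval (x j) := by
      conv_lhs => rw [← Polynomial.modByMonic_add_div (p i) Q]
      simp [hroot]
    rw [Matrix.of_apply, heval, Polynomial.eval_eq_sum_range' hlt, Matrix.mul_apply,
      ← Fin.sum_univ_eq_sum_range (fun k => (p i %ₘ Q).coeff k * x j ^ k)]
    simp [Matrix.vandermonde_apply, mul_comm]
  rw [key, Matrix.det_mul]
  exact dvd_mul_right _ _

theorem exists_polynomial_zpow_sub_zpow_neg (m : ℤ) :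
    ∃ p : Polynomial ℂ, ∀ x : ℂ, x ≠ 0 →
      x ^ m - x ^ (-m) = (x - x⁻¹) * p.eval (x + x⁻¹) := by
  have nat_case : ∀ k : ℕ, (∃ p : Polynomial ℂ, ∀ x : ℂ, x ≠ 0 →
      x ^ k - x⁻¹ ^ k = (x - x⁻¹) * p.eval (x + x⁻¹)) ∧ ∃ p : Polynomial ℂ, ∀ x : ℂ, x ≠ 0 →
      x ^ (k + 1) - x⁻¹ ^ (k + 1) = (x - x⁻¹) * p.eval (x + x⁻¹) := by
    intro k
    induction k with
    | zero => exact ⟨⟨0, by simp⟩, ⟨1, by simp⟩⟩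
    | succ k ih =>
      obtain ⟨⟨p, hp⟩, q, hq⟩ := ih
      refine ⟨⟨q, hq⟩, Polynomial.X * q - p, fun x hx => ?_⟩
      have h1 : x * x⁻¹ = 1 := mul_inv_cancel₀ hx
      simp only [Polynomial.eval_sub, Polynomial.eval_mul, Polynomial.eval_X]
      linear_combination (x + x⁻¹) * hq x hx - hp x hx - (x ^ k - x⁻¹ ^ k) * h1
  obtain ⟨k, rfl | rfl⟩ := m.eq_nat_or_neg
  · simpa using (nat_case k).1
  · obtain ⟨p, hp⟩ := (nat_case k).1
    refine ⟨-p, fun x hx => ?_⟩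
    have := hp x hx
    simp only [neg_neg, zpow_neg, zpow_natCast, Polynomial.eval_neg, inv_pow] at this ⊢
    linear_combination -this

/-- The Weyl denominator of type `C`. -/
noncomputable def weylDenom {n : ℕ} (z : Fin n → ℂ) : ℂ :=
  (∏ i, (z i - (z i)⁻¹)) * (Matrix.vandermonde fun i => z i + (z i)⁻¹).det

/-- The determinant character of the hyperoctahedral group. -/
def bnSign {n : ℕ} (σ : Equiv.Perm (Fin n)) (ε : Fin n → Bool) : ℂ :=
  (Equiv.Perm.sign σ : ℤ) * ∏ i, if ε i then (-1 : ℂ) else 1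

theorem bnSign_mul_self {n : ℕ} (σ : Equiv.Perm (Fin n)) (ε : Fin n → Bool) :
    bnSign σ ε * bnSign σ ε = 1 := by
  rw [bnSign, mul_mul_mul_comm, ← Finset.prod_mul_distrib, ← Int.cast_mul, ← Units.val_mul,
    Int.units_mul_self, Finset.prod_eq_one fun i _ => by split_ifs <;> norm_num]
  simp

theorem bnAct_ne_zero {n : ℕ} (σ : Equiv.Perm (Fin n)) (ε : Fin n → Bool) {z : Fin n → ℂ}
    (hz : ∀ i, z i ≠ 0) (i : Fin n) : bnAct σ ε z i ≠ 0 := by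
  unfold bnAct
  split_ifs
  · exact inv_ne_zero (hz _)
  · exact hz _

theorem weylDenom_bnAct {n : ℕ} (σ : Equiv.Perm (Fin n)) (ε : Fin n → Bool) (z : Fin n → ℂ) :
    weylDenom (bnAct σ ε z) = bnSign σ ε * weylDenom z := by
  have h1 : ∀ i, bnAct σ ε z i - (bnAct σ ε z i)⁻¹ =
      (if ε i then (-1 : ℂ) else 1) * (z (σ i) - (z (σ i))⁻¹) := fun i => by
    unfold bnAct
    split_ifs <;> simp
  have h2 : (fun i => bnAct σ ε z i + (bnAct σ ε z i)⁻¹) =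
      fun i => z (σ i) + (z (σ i))⁻¹ := by
    funext i
    unfold bnAct
    split_ifs <;> simp [add_comm]
  have h3 : (Matrix.vandermonde fun i => z (σ i) + (z (σ i))⁻¹).det =
      (Equiv.Perm.sign σ : ℤ) * (Matrix.vandermonde fun i => z i + (z i)⁻¹).det :=
    Matrix.det_permute σ (Matrix.vandermonde fun i => z i + (z i)⁻¹)
  rw [weylDenom, h2, h3, Finset.prod_congr rfl fun i _ => h1 i, Finset.prod_mul_distrib,
    Equiv.prod_comp σ fun i => z i - (z i)⁻¹, weylDenom, bnSign]
  ring

theorem weylDenom_ne_zero {n : ℕ} {z : Fin n → ℂ} (hz : genericZ z) : weylDenom z ≠ 0 := by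
  refine mul_ne_zero (Finset.prod_ne_zero_iff.2 fun i _ h => ?_)
    (Matrix.det_vandermonde_ne_zero_iff.2 fun i j h => ?_)
  · have h0 := (hz.1 i).1
    apply (hz.1 i).2
    have := mul_inv_cancel₀ h0
    linear_combination z i * h + this
  · by_contra hij
    obtain ⟨h1, h2⟩ := hz.2 i j hij
    have hi := mul_inv_cancel₀ (hz.1 i).1
    have hj := mul_inv_cancel₀ (hz.1 j).1
    have : (z i * z j - 1) * (z i - z j) = 0 := by
      linear_combination z i * z j * h - z j * hi + z i * hj
    rcases mul_eq_zero.1 this with h | h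
    · exact h1 (sub_eq_zero.1 h)
    · exact h2 (sub_eq_zero.1 h)

theorem sum_bnSign_mul_monomial {n : ℕ} (μ : Fin n → ℤ) (z : Fin n → ℂ) :
    ∑ σ : Equiv.Perm (Fin n), ∑ ε : Fin n → Bool,
      bnSign σ ε * ∏ i, bnAct σ ε z i ^ μ i =
    (Matrix.of fun j i => z j ^ μ i - z j ^ (-μ i)).det := by
  rw [Matrix.det_apply']
  refine Finset.sum_congr rfl fun σ _ => ?_
  have h : ∀ i, z (σ i) ^ μ i - z (σ i) ^ (-μ i) = ∑ e : Bool,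
      (if e then (-1 : ℂ) else 1) * (if e then (z (σ i))⁻¹ else z (σ i)) ^ μ i := fun i => by
    simp
    ring
  simp only [Matrix.of_apply]
  rw [Finset.prod_congr rfl fun i _ => h i, Finset.prod_univ_sum, Fintype.piFinset_univ,
    Finset.mul_sum]
  refine Finset.sum_congr rfl fun ε _ => ?_
  rw [Finset.prod_mul_distrib, bnSign, mul_assoc]
  rfl

/-- The antisymmetrization of a monomial is divisible by the Weyl denominator. -/
theorem weylDenom_dvd_antisymmetrized_monomial {n : ℕ} (μ : Fin n → ℤ) :
    ∃ q : LaurentRing n, ∀ z (hz : ∀ i, z i ≠ 0),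
      ∑ σ : Equiv.Perm (Fin n), ∑ ε : Fin n → Bool,
        bnSign σ ε * ∏ i, bnAct σ ε z i ^ μ i = weylDenom z * laurentEval z hz q := by
  choose p hp using exists_polynomial_zpow_sub_zpow_neg
  have hX : ∀ i : Fin n, ∃ X : LaurentRing n, ∀ z (hz : ∀ i, z i ≠ 0),
      z i + (z i)⁻¹ = laurentEval z hz X := fun i => by
    obtain ⟨P, hP⟩ := IsLaurent.coord i
    obtain ⟨Q, hQ⟩ := IsLaurent.inv_coord i
    exact ⟨P + Q, fun z hz => by rw [map_add, ← hP, ← hQ]⟩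
  choose X hX using hX
  obtain ⟨q, hq⟩ := det_vandermonde_dvd_det_eval
    (fun i => (p (μ i)).map (algebraMap ℂ (LaurentRing n))) X
  refine ⟨q, fun z hz => ?_⟩
  have hq' := congrArg (laurentEval z hz) hq
  rw [map_mul, AlgHom.map_det, AlgHom.map_det] at hq'
  have hV : (laurentEval z hz).mapMatrix (Matrix.vandermonde X) =
      Matrix.vandermonde fun i => z i + (z i)⁻¹ := by
    ext i j
    simp [Matrix.vandermonde_apply, hX i z hz]
  have hM : (laurentEval z hz).mapMatrix (Matrix.of fun j i =>
      ((p (μ i)).map (algebraMap ℂ (LaurentRing n))).eval (X j)) =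
      Matrix.of fun j i => (p (μ i)).eval (z j + (z j)⁻¹) := by
    ext j i
    simp only [AlgHom.mapMatrix_apply, Matrix.map_apply, Matrix.of_apply, hX j z hz]
    rw [Polynomial.eval_map_algebraMap, ← Polynomial.aeval_algHom_apply,
      Polynomial.coe_aeval_eq_eval]
  rw [hV, hM] at hq'
  have hD : (Matrix.of fun j i => z j ^ μ i - z j ^ (-μ i)) =
      Matrix.of fun j i => (z j - (z j)⁻¹) *
        (Matrix.of fun j i => (p (μ i)).eval (z j + (z j)⁻¹)) j i := by
    ext j i
    simp [← hp (μ i) (z j) (hz j)]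
  rw [sum_bnSign_mul_monomial, hD, Matrix.det_mul_column, hq', weylDenom, mul_assoc]

/-- The antisymmetrization of a Laurent polynomial is divisible by the Weyl denominator. -/
theorem weylDenom_dvd_antisymmetrization {n : ℕ} {f : (Fin n → ℂ) → ℂ} (hf : IsLaurent f) :
    ∃ q : LaurentRing n, ∀ z (hz : ∀ i, z i ≠ 0),
      ∑ σ : Equiv.Perm (Fin n), ∑ ε : Fin n → Bool, bnSign σ ε * f (bnAct σ ε z) =
        weylDenom z * laurentEval z hz q := by
  obtain ⟨P, hP⟩ := hf
  choose q hq using weylDenom_dvd_antisymmetrized_monomial (n := n)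
  refine ⟨∑ μ ∈ P.coeff.support, P.coeff μ • q μ, fun z hz => ?_⟩
  simp only [hP _ (bnAct_ne_zero _ _ hz), laurentEval_apply (bnAct _ _ z), map_sum, map_smul,
    Finset.mul_sum, smul_eq_mul]
  rw [Finset.sum_congr rfl fun σ _ => Finset.sum_comm, Finset.sum_comm]
  refine Finset.sum_congr rfl fun μ _ => ?_
  rw [mul_left_comm, ← hq μ z hz, Finset.mul_sum]
  refine Finset.sum_congr rfl fun σ _ => ?_
  rw [Finset.mul_sum]
  exact Finset.sum_congr rfl fun ε _ => mul_left_comm _ _ _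

theorem exists_isLaurent_uLam_eq_div {n : ℕ} (i : Fin n) (l : ℤ) (a b t0 t1 t2 t3 : ℂ) :
    ∃ f : (Fin n → ℂ) → ℂ, IsLaurent f ∧ ∀ y : Fin n → ℂ, y i ≠ 0 →
      uLam l a b t0 t1 t2 t3 (y i) = f y / (y i - (y i)⁻¹) := by
  have hlin : ∀ c : ℂ, IsLaurent fun y : Fin n → ℂ => 1 - c * (y i)⁻¹ := fun c =>
    (IsLaurent.const 1).sub ((IsLaurent.const c).mul (IsLaurent.inv_coord i))
  have hden : ∀ x : ℂ, x ≠ 0 → 1 - x⁻¹ ^ 2 = x⁻¹ * (x - x⁻¹) := fun x hx => by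
    rw [mul_sub, inv_mul_cancel₀ hx, sq]
  by_cases hl : l = 0
  · refine ⟨_, (((hlin a).mul (hlin b)).mul (IsLaurent.coord i)), fun y hy => ?_⟩
    rw [uLam, if_pos hl, hden _ hy, ← div_div, div_inv_eq_mul]
  · refine ⟨_, ((IsLaurent.zpow i l).mul
      ((((hlin t0).mul (hlin t1)).mul (hlin t2)).mul (hlin t3))).mul (IsLaurent.coord i),
      fun y hy => ?_⟩
    rw [uLam, if_neg hl, hden _ hy, ← div_div, div_inv_eq_mul]

theorem exists_isLaurent_Rbase_eq_div {n : ℕ} (lam : Fin n → ℤ) (t a b t0 t1 t2 t3 : ℂ) :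
    ∃ f : (Fin n → ℂ) → ℂ, IsLaurent f ∧ ∀ y : Fin n → ℂ, (∀ i, y i ≠ 0) →
      Rbase lam t a b t0 t1 t2 t3 y = f y / weylDenom y := by
  choose u hu hu' using fun i : Fin n => exists_isLaurent_uLam_eq_div i (lam i) a b t0 t1 t2 t3
  have hpair : ∀ i j : Fin n, IsLaurent fun y : Fin n → ℂ =>
      ((1 - t * (y i)⁻¹ * y j) * (1 - t * (y i)⁻¹ * (y j)⁻¹)) * ((-1) * y i) := fun i j => by
    have hi : IsLaurent fun y : Fin n → ℂ => t * (y i)⁻¹ :=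
      (IsLaurent.const t).mul (IsLaurent.inv_coord i)
    exact (((IsLaurent.const 1).sub (hi.mul (IsLaurent.coord j))).mul
      ((IsLaurent.const 1).sub (hi.mul (IsLaurent.inv_coord j)))).mul
      ((IsLaurent.const (-1)).mul (IsLaurent.coord i))
  refine ⟨_, (IsLaurent.prod univ fun i _ => hu i).mul
    (IsLaurent.prod univ fun i _ => IsLaurent.prod (Finset.Ioi i) fun j _ => hpair i j),
    fun y hy => ?_⟩
  rw [Rbase, weylDenom, Matrix.det_vandermonde, mul_div_mul_comm, ← Finset.prod_div_distrib,
    ← Finset.prod_div_distrib]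
  congr 1
  · exact Finset.prod_congr rfl fun i _ => hu' i y (hy i)
  · refine Finset.prod_congr rfl fun i _ => ?_
    rw [← Finset.prod_div_distrib, ← Finset.prod_filter,
      show Finset.univ.filter (fun j => i < j) = Finset.Ioi i by ext; simp]
    refine Finset.prod_congr rfl fun j _ => ?_
    have hi := mul_inv_cancel₀ (hy i)
    have hj := mul_inv_cancel₀ (hy j)
    have hden : (1 - (y i)⁻¹ * y j) * (1 - (y i)⁻¹ * (y j)⁻¹) =
        ((-1) * y i)⁻¹ * (y j + (y j)⁻¹ - (y i + (y i)⁻¹)) := by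
      rw [mul_inv, inv_neg, inv_one]
      linear_combination (y i)⁻¹ ^ 2 * hj - hi
    rw [hden, ← div_div, div_inv_eq_mul]

theorem bnAct_bnAct {n : ℕ} (σ τ : Equiv.Perm (Fin n)) (ε δ : Fin n → Bool) (z : Fin n → ℂ) :
    bnAct τ δ (bnAct σ ε z) = bnAct (σ * τ) (fun i => xor (δ i) (ε (τ i))) z := by
  funext i
  simp only [bnAct, Equiv.Perm.mul_apply]
  by_cases h1 : δ i = true <;> by_cases h2 : ε (τ i) = true <;> simp [h1, h2]

theorem sum_bnAct_bnAct {n : ℕ} (F : (Fin n → ℂ) → ℂ) (σ : Equiv.Perm (Fin n))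
    (ε : Fin n → Bool) (z : Fin n → ℂ) :
    ∑ τ : Equiv.Perm (Fin n), ∑ δ : Fin n → Bool, F (bnAct τ δ (bnAct σ ε z)) =
      ∑ τ : Equiv.Perm (Fin n), ∑ δ : Fin n → Bool, F (bnAct τ δ z) := by
  simp only [bnAct_bnAct]
  rw [← Equiv.sum_comp (Equiv.mulLeft σ) fun τ => ∑ δ : Fin n → Bool, F (bnAct τ δ z)]
  refine Finset.sum_congr rfl fun τ _ => ?_
  have hinv : Function.Involutive fun (δ : Fin n → Bool) i => xor (δ i) (ε (τ i)) := fun δ => by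
    funext i
    simp
  exact Equiv.sum_comp hinv.toPerm fun δ => F (bnAct (σ * τ) δ z)

/-- `K_λ^{(n)}` is a `BC_n`-symmetric Laurent polynomial: on generic points it agrees
with a Laurent polynomial (a finite linear combination of monomials `z^μ`, `μ ∈ ℤⁿ`),
and it is invariant under the hyperoctahedral group `B_n` (permuting and inverting the
variables). -/
theorem K_is_BC_symmetric_Laurent (n : ℕ) (lam : Fin n → ℤ) (hlam : isPartition lam)
    (t a b t0 t1 t2 t3 : ℂ) (hv : vlam lam t a b t0 t1 t2 t3 ≠ 0) :
    (∃ coef : (Fin n → ℤ) →₀ ℂ,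
      ∀ z : Fin n → ℂ, genericZ z →
        Kpoly lam t a b t0 t1 t2 t3 z = ∑ μ ∈ coef.support, coef μ * ∏ i : Fin n, z i ^ μ i) ∧
    ∀ z : Fin n → ℂ, genericZ z → ∀ (σ : Equiv.Perm (Fin n)) (ε : Fin n → Bool),
      Kpoly lam t a b t0 t1 t2 t3 (bnAct σ ε z) = Kpoly lam t a b t0 t1 t2 t3 z := by
  refine ⟨?_, fun z _ σ ε => ?_⟩
  · obtain ⟨f, hf, hR⟩ := exists_isLaurent_Rbase_eq_div lam t a b t0 t1 t2 t3
    obtain ⟨q, hq⟩ := weylDenom_dvd_antisymmetrization hf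
    refine ⟨((vlam lam t a b t0 t1 t2 t3)⁻¹ • q).coeff, fun z hz => ?_⟩
    have h0 : ∀ i, z i ≠ 0 := fun i => (hz.1 i).1
    have hterm : ∀ (σ : Equiv.Perm (Fin n)) (ε : Fin n → Bool),
        Rbase lam t a b t0 t1 t2 t3 (bnAct σ ε z) =
          bnSign σ ε * f (bnAct σ ε z) / weylDenom z := fun σ ε => by
      rw [hR _ (bnAct_ne_zero σ ε h0), weylDenom_bnAct, ← div_div,
        div_eq_mul_inv (f _) (bnSign σ ε), inv_eq_of_mul_eq_one_left (bnSign_mul_self σ ε),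
        mul_comm (f _)]
    rw [← laurentEval_apply z h0, map_smul, smul_eq_mul, Kpoly]
    simp only [hterm, ← Finset.sum_div]
    rw [hq z h0, mul_div_cancel_left₀ _ (weylDenom_ne_zero hz)]
  · rw [Kpoly, Kpoly, sum_bnAct_bnAct]
end
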